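/- Let Γ and G be countable discrete groups, let P be a Γ-invariant probability measure on [Γ,G], and let f: G → ℂ be a bounded positive definite function on G. Define f̂: Γ → ℂ by f̂(γ) = ∫_{[Γ,G]} f(h(γ)) dP(h). Then f̂ is a positive definite function on Γ. -/

import Mathlib

open MeasureTheory
open scoped ComplexOrder

/-- `[Γ,G]`: the set of injective maps `h : Γ → G` with `h 1 = 1`, as a subset of the
product space `G^Γ`. -/
def embSet (Γ G : Type*) [Group Γ] [Group G] : Set (Γ → G) :=
  {h | Function.Injective h ∧ h 1 = 1}

/-- The action of `Γ` on maps `h : Γ → G`: `(γ·h)(t) = h(tγ) h(γ)⁻¹`. -/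
def gammaAct {Γ G : Type*} [Group Γ] [Group G] (γ : Γ) (h : Γ → G) : Γ → G :=
  fun t => h (t * γ) * (h γ)⁻¹

/-- A function `f : G → ℂ` is positive definite if for every finitely supported
`x : G → ℂ` one has `∑_{s,t} f(st⁻¹) x(s) conj(x(t)) ≥ 0`. -/
def IsPosDef {G : Type*} [Group G] (f : G → ℂ) : Prop :=
  ∀ (s : Finset G) (x : G → ℂ),
    0 ≤ ∑ a ∈ s, ∑ b ∈ s, f (a * b⁻¹) * x a * (starRingEnd ℂ) (x b)

theorem measurable_gammaAct {Γ G : Type*} [Group Γ] [Group G] [Countable G]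
    [MeasurableSpace G] [DiscreteMeasurableSpace G] (γ : Γ) :
    Measurable (gammaAct γ : (Γ → G) → Γ → G) :=
  measurable_pi_lambda _ fun t =>
    (Measurable.of_discrete (f := fun p : G × G => p.1 * p.2⁻¹)).comp
      (f := fun h : Γ → G => (h (t * γ), h γ))
      ((measurable_pi_apply (t * γ)).prodMk (measurable_pi_apply γ))

/-- Invariance of `P` under `t` rewrites the integral of `f (h (s * t⁻¹))`. -/
theorem integral_mul_inv_eq_of_invariant {Γ G : Type*} [Group Γ] [Group G] [Countable G]
    [MeasurableSpace G] [DiscreteMeasurableSpace G] {P : Measure (Γ → G)}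
    (hinv : ∀ γ : Γ, Measure.map (gammaAct γ) P = P) (f : G → ℂ) (s t : Γ) :
    ∫ h, f (h (s * t⁻¹)) ∂P = ∫ h, f (h s * (h t)⁻¹) ∂P := by
  have hf : Measurable fun h : Γ → G => f (h (s * t⁻¹)) :=
    Measurable.of_discrete.comp (measurable_pi_apply _)
  conv_lhs => rw [← hinv t]
  rw [integral_map (measurable_gammaAct t).aemeasurable hf.aestronglyMeasurable]
  simp [gammaAct]

theorem IsPosDef.sum_comp_injective_nonneg {ι G : Type*} [Group G] {f : G → ℂ} (hf : IsPosDef f)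
    {h : ι → G} (hh : Function.Injective h) (s : Finset ι) (x : ι → ℂ) :
    0 ≤ ∑ a ∈ s, ∑ b ∈ s, f (h a * (h b)⁻¹) * x a * (starRingEnd ℂ) (x b) := by
  simpa [hh.extend_apply] using hf (s.map ⟨h, hh⟩) (Function.extend h x 0)

/-- If `P` is a `Γ`-invariant probability measure on `[Γ,G]` and `f` is a bounded
positive definite function on `G`, then `f̂(γ) = ∫ f(h(γ)) dP(h)` is a positive
definite function on `Γ`. -/
theorem statement11 (Γ G : Type*) [Group Γ] [Group G] [Countable Γ] [Countable G]
    [MeasurableSpace G] [DiscreteMeasurableSpace G]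
    (P : Measure (Γ → G)) [IsProbabilityMeasure P]
    (hsupp : P (embSet Γ G)ᶜ = 0)
    (hinv : ∀ γ : Γ, Measure.map (gammaAct γ) P = P)
    (f : G → ℂ) (hfb : ∃ C : ℝ, ∀ g : G, ‖f g‖ ≤ C) (hf : IsPosDef f) :
    IsPosDef fun γ : Γ => ∫ h, f (h γ) ∂P := by
  obtain ⟨C, hC⟩ := hfb
  intro s x
  have hint (a b : Γ) : Integrable (fun h : Γ → G => f (h a * (h b)⁻¹)) P := by
    have hm : Measurable fun h : Γ → G => f (h a * (h b)⁻¹) :=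
      (Measurable.of_discrete (f := fun p : G × G => f (p.1 * p.2⁻¹))).comp
        (f := fun h : Γ → G => (h a, h b))
        ((measurable_pi_apply a).prodMk (measurable_pi_apply b))
    exact .of_bound hm.aestronglyMeasurable C (.of_forall fun h => hC _)
  have hterm (a b : Γ) :
      Integrable (fun h : Γ → G => f (h a * (h b)⁻¹) * x a * (starRingEnd ℂ) (x b)) P :=
    ((hint a b).mul_const _).mul_const _
  have hsum : ∑ a ∈ s, ∑ b ∈ s, (∫ h, f (h (a * b⁻¹)) ∂P) * x a * (starRingEnd ℂ) (x b) =
      ∫ h, ∑ a ∈ s, ∑ b ∈ s, f (h a * (h b)⁻¹) * x a * (starRingEnd ℂ) (x b) ∂P := by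
    rw [integral_finsetSum _ fun a _ => integrable_finsetSum _ fun b _ => hterm a b]
    refine Finset.sum_congr rfl fun a _ => ?_
    rw [integral_finsetSum _ fun b _ => hterm a b]
    refine Finset.sum_congr rfl fun b _ => ?_
    rw [integral_mul_const, integral_mul_const, integral_mul_inv_eq_of_invariant hinv]
  rw [hsum]
  have hemb : ∀ᵐ h ∂P, h ∈ embSet Γ G := hsupp
  refine integral_nonneg_of_ae ?_
  filter_upwards [hemb] with h hh
  exact hf.sum_comp_injective_nonneg hh.1 s x
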